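/- arXiv:1911.05255 — 4 statements merged into one kernel-verified Lean document; each statement's English description precedes it below -/
import Mathlib

section
/- For all natural numbers n ≥ k ≥ 1 and almost every x ∈ ℝ, the B-spline B_n is k-times differentiable at x and B_n^{(k)}(x) = Σ_{ν=0}^{k} ((−1)^ν k!/(ν!(k−ν)!)) B_{n−k}(x−ν). -/
open MeasureTheory intervalIntegral

/-- The B-splines: `B_0 = χ_{[0,1)}` and `B_n = B_{n-1} ∗ B_0`. -/
noncomputable def Bspline : ℕ → ℝ → ℝ
  | 0 => Set.indicator (Set.Ico (0 : ℝ) 1) (fun _ => 1)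
  | n + 1 => fun x => ∫ t in (0:ℝ)..1, Bspline n (x - t)

theorem Bspline_succ_eq_integral (m : ℕ) (x : ℝ) :
    Bspline (m + 1) x = ∫ t in (x - 1)..x, Bspline m t := by
  simp [Bspline]

theorem intervalIntegrable_Bspline (m : ℕ) (a b : ℝ) :
    IntervalIntegrable (Bspline m) volume a b := by
  induction m generalizing a b with
  | zero =>
    have h : Integrable (Bspline 0) := by
      rw [Bspline, integrable_indicator_iff measurableSet_Ico]
      exact integrableOn_const (by simp)
    exact h.intervalIntegrable
  | succ m ih =>
    have hF : Continuous fun x => ∫ t in (0 : ℝ)..x, Bspline m t :=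
      continuous_primitive ih 0
    refine ((hF.sub (hF.comp (continuous_sub_right 1))).congr fun x => ?_).intervalIntegrable a b
    rw [Bspline_succ_eq_integral]
    exact integral_interval_sub_left (ih _ _) (ih _ _)

theorem Bspline_succ_eq_sub (m : ℕ) :
    Bspline (m + 1) = fun x =>
      (∫ t in (0 : ℝ)..x, Bspline m t) - ∫ t in (0 : ℝ)..(x - 1), Bspline m t := by
  funext x
  have hi := intervalIntegrable_Bspline m
  rw [Bspline_succ_eq_integral, integral_interval_sub_left (hi _ _) (hi _ _)]

theorem stronglyMeasurable_Bspline (m : ℕ) : StronglyMeasurable (Bspline m) := by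
  cases m with
  | zero => exact stronglyMeasurable_const.indicator measurableSet_Ico
  | succ m =>
    have hF : Continuous fun x => ∫ t in (0 : ℝ)..x, Bspline m t :=
      continuous_primitive (intervalIntegrable_Bspline m) 0
    rw [Bspline_succ_eq_sub]
    exact (hF.sub (hF.comp (continuous_sub_right 1))).stronglyMeasurable

theorem hasDerivAt_Bspline_succ_of_continuousAt {m : ℕ} {x : ℝ}
    (hx : ContinuousAt (Bspline m) x) (hx' : ContinuousAt (Bspline m) (x - 1)) :
    HasDerivAt (Bspline (m + 1)) (Bspline m x - Bspline m (x - 1)) x := by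
  have hF : ∀ y, ContinuousAt (Bspline m) y →
      HasDerivAt (fun u => ∫ t in (0 : ℝ)..u, Bspline m t) (Bspline m y) y := fun y hy =>
    integral_hasDerivAt_right (intervalIntegrable_Bspline m _ _)
      (stronglyMeasurable_Bspline m).stronglyMeasurableAtFilter hy
  rw [Bspline_succ_eq_sub]
  exact (hF x hx).sub ((hF (x - 1) hx').comp_sub_const x 1)

theorem sub_natCast_notMem_range_intCast {x : ℝ} (hx : x ∉ Set.range ((↑) : ℤ → ℝ)) (k : ℕ) :
    x - k ∉ Set.range ((↑) : ℤ → ℝ) := by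
  rintro ⟨z, hz⟩
  exact hx ⟨z + k, by push_cast; linarith⟩

theorem continuousAt_Bspline (m : ℕ) {x : ℝ} (hx : x ∉ Set.range ((↑) : ℤ → ℝ)) :
    ContinuousAt (Bspline m) x := by
  induction m generalizing x with
  | zero =>
    rw [Bspline]
    refine continuousOn_const.continuousAt_indicator ?_
    rw [frontier_Ico zero_lt_one]
    rintro (h | h)
    · exact hx ⟨0, by simp [h]⟩
    · exact hx ⟨1, by simpa using h.symm⟩
  | succ m ih =>
    exact (hasDerivAt_Bspline_succ_of_continuousAt (ih hx)
      (ih (by simpa using sub_natCast_notMem_range_intCast hx 1))).continuousAt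

theorem hasDerivAt_Bspline_succ (m : ℕ) {x : ℝ} (hx : x ∉ Set.range ((↑) : ℤ → ℝ)) :
    HasDerivAt (Bspline (m + 1)) (Bspline m x - Bspline m (x - 1)) x :=
  hasDerivAt_Bspline_succ_of_continuousAt (continuousAt_Bspline m hx)
    (continuousAt_Bspline m (by simpa using sub_natCast_notMem_range_intCast hx 1))

theorem sum_choose_mul_shift_sub (g : ℝ → ℝ) (k : ℕ) (x : ℝ) :
    ∑ ν ∈ Finset.range (k + 1),
        ((-1 : ℝ) ^ ν * k.choose ν) * (g (x - ν) - g (x - ν - 1)) =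
      ∑ ν ∈ Finset.range (k + 2), ((-1 : ℝ) ^ ν * (k + 1).choose ν) * g (x - ν) := by
  have h := Finset.sum_choose_succ_mul (fun i _ => (-1 : ℝ) ^ i * g (x - i)) k
  calc
    _ = ∑ ν ∈ Finset.range (k + 1),
          (k.choose ν : ℝ) * ((-1 : ℝ) ^ (ν + 1) * g (x - (ν + 1 : ℕ))) +
        ∑ ν ∈ Finset.range (k + 1), (k.choose ν : ℝ) * ((-1 : ℝ) ^ ν * g (x - ν)) := by
        rw [← Finset.sum_add_distrib]
        refine Finset.sum_congr rfl fun ν _ => ?_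
        rw [Nat.cast_succ, ← sub_sub]
        ring
    _ = _ := by
        rw [add_comm, ← h]
        refine Finset.sum_congr rfl fun ν _ => ?_
        ring

theorem hasDerivAt_sum_choose_mul_Bspline (m k : ℕ) {x : ℝ}
    (hx : x ∉ Set.range ((↑) : ℤ → ℝ)) :
    HasDerivAt
      (fun y => ∑ ν ∈ Finset.range (k + 1),
        ((-1 : ℝ) ^ ν * k.choose ν) * Bspline (m + 1) (y - ν))
      (∑ ν ∈ Finset.range (k + 2), ((-1 : ℝ) ^ ν * (k + 1).choose ν) * Bspline m (x - ν)) x := by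
  rw [← sum_choose_mul_shift_sub]
  exact HasDerivAt.fun_sum fun ν _ =>
    ((hasDerivAt_Bspline_succ m
      (sub_natCast_notMem_range_intCast hx ν)).comp_sub_const x (ν : ℝ)).const_mul _

theorem eventually_notMem_range_intCast {x : ℝ} (hx : x ∉ Set.range ((↑) : ℤ → ℝ)) :
    ∀ᶠ y in nhds x, y ∉ Set.range ((↑) : ℤ → ℝ) :=
  Int.isClosedEmbedding_coe_real.isClosed_range.isOpen_compl.mem_nhds hx

theorem iteratedDeriv_Bspline_add (m k : ℕ) {x : ℝ} (hx : x ∉ Set.range ((↑) : ℤ → ℝ)) :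
    iteratedDeriv k (Bspline (m + k)) x =
      ∑ ν ∈ Finset.range (k + 1), ((-1 : ℝ) ^ ν * k.choose ν) * Bspline m (x - ν) := by
  induction k generalizing m x with
  | zero => simp
  | succ k ih =>
    rw [iteratedDeriv_succ, show m + (k + 1) = m + 1 + k by ring]
    exact ((hasDerivAt_sum_choose_mul_Bspline m k hx).congr_of_eventuallyEq
      ((eventually_notMem_range_intCast hx).mono fun y hy => ih (m + 1) hy)).deriv

theorem differentiableAt_iteratedDeriv_Bspline {n j : ℕ} (hj : j < n) {x : ℝ}
    (hx : x ∉ Set.range ((↑) : ℤ → ℝ)) :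
    DifferentiableAt ℝ (iteratedDeriv j (Bspline n)) x := by
  obtain ⟨m, rfl⟩ : ∃ m, n = m + 1 + j := ⟨n - j - 1, by omega⟩
  exact ((hasDerivAt_sum_choose_mul_Bspline m j hx).congr_of_eventuallyEq
    ((eventually_notMem_range_intCast hx).mono fun y hy =>
      iteratedDeriv_Bspline_add (m + 1) j hy)).differentiableAt

/-- For `n ≥ k ≥ 1` and almost every `x ∈ ℝ`, `B_n` is `k`-times differentiable at `x` and
`B_n^{(k)}(x) = ∑_{ν=0}^{k} ((-1)^ν k! / (ν! (k-ν)!)) B_{n-k}(x - ν)`. -/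
theorem bspline_iteratedDeriv_ae (n k : ℕ) (hk : 1 ≤ k) (hkn : k ≤ n) :
    ∀ᵐ x : ℝ,
      (∀ j < k, DifferentiableAt ℝ (iteratedDeriv j (Bspline n)) x) ∧
      iteratedDeriv k (Bspline n) x =
        ∑ ν ∈ Finset.range (k + 1),
          ((-1 : ℝ) ^ ν * (Nat.factorial k) / ((Nat.factorial ν) * (Nat.factorial (k - ν)))) *
            Bspline (n - k) (x - (ν : ℝ)) := by
  filter_upwards [(Set.countable_range ((↑) : ℤ → ℝ)).ae_notMem volume] with x hx
  refine ⟨fun j hj => differentiableAt_iteratedDeriv_Bspline (hj.trans_le hkn) hx, ?_⟩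
  have h := iteratedDeriv_Bspline_add (n - k) k hx
  rw [Nat.sub_add_cancel hkn] at h
  rw [h]
  refine Finset.sum_congr rfl fun ν hν => ?_
  rw [Nat.cast_choose ℝ (Finset.mem_range_succ_iff.1 hν), mul_div_assoc]
end

section
/- For every n ∈ ℕ₀ and every t ∈ ℝ, the autocorrelation of the B-spline B_n satisfies ∫_ℝ B_n(x) B_n(x+t) dx = B_{2n+1}(n+1+t). -/
open MeasureTheory intervalIntegral

theorem Bspline_succ (n : ℕ) (x : ℝ) :
    Bspline (n + 1) x = ∫ s in (0:ℝ)..1, Bspline n (x - s) := rfl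

theorem measurable_Bspline (n : ℕ) : Measurable (Bspline n) := by
  induction n with
  | zero => exact measurable_const.indicator measurableSet_Ico
  | succ n ih =>
    have h : StronglyMeasurable fun x : ℝ => ∫ s in Set.Ioc (0:ℝ) 1, Bspline n (x - s) :=
      StronglyMeasurable.integral_prod_right (f := fun x s : ℝ => Bspline n (x - s))
        (ih.comp (measurable_fst.sub measurable_snd)).stronglyMeasurable
    convert h.measurable using 1
    ext x
    rw [Bspline_succ, integral_of_le zero_le_one]

theorem norm_Bspline_le_one (n : ℕ) (x : ℝ) : ‖Bspline n x‖ ≤ 1 := by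
  induction n generalizing x with
  | zero =>
    refine (norm_indicator_le_norm_self _ x).trans ?_
    simp
  | succ n ih =>
    simpa [Bspline_succ] using
      norm_integral_le_of_norm_le_const (a := (0:ℝ)) (b := 1) fun s _ => ih (x - s)

theorem Bspline_eq_zero_of_notMem (n : ℕ) (x : ℝ) (hx : x ∉ Set.Icc (0 : ℝ) (n + 1)) :
    Bspline n x = 0 := by
  induction n generalizing x with
  | zero =>
    refine Set.indicator_of_notMem (fun h => hx ?_) _
    simpa using Set.Ico_subset_Icc_self h
  | succ n ih =>
    rw [Bspline_succ]
    refine integral_zero_ae (Filter.Eventually.of_forall fun s hs => ih _ fun h => hx ?_)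
    rw [Set.uIoc_of_le zero_le_one] at hs
    push_cast
    exact ⟨by linarith [h.1, hs.1], by linarith [h.2, hs.2]⟩

theorem integrable_Bspline (n : ℕ) : Integrable (Bspline n) := by
  have h : IntegrableOn (Bspline n) (Set.Icc (0 : ℝ) (n + 1)) :=
    Measure.integrableOn_of_bounded (M := 1) (by simp)
      (measurable_Bspline n).aestronglyMeasurable
      (Filter.Eventually.of_forall (norm_Bspline_le_one n))
  exact (integrableOn_iff_integrable_of_support_subset fun x hx => by
    by_contra hx'
    exact hx (Bspline_eq_zero_of_notMem n x hx')).1 h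

/-- The splines are symmetric about the midpoint of their support, up to the two endpoints. -/
theorem ae_Bspline_symm (n : ℕ) : ∀ᵐ x : ℝ, Bspline n (n + 1 - x) = Bspline n x := by
  induction n with
  | zero =>
    filter_upwards [Measure.ae_ne volume (0 : ℝ), Measure.ae_ne volume (1 : ℝ)] with x h0 h1
    have h : (((0 : ℕ) : ℝ) + 1 - x ∈ Set.Ico (0 : ℝ) 1) ↔ x ∈ Set.Ico (0 : ℝ) 1 := by
      simp only [Set.mem_Ico, Nat.cast_zero]
      constructor
      · rintro ⟨h2, h3⟩
        exact ⟨by linarith, lt_of_le_of_ne (by linarith) h1⟩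
      · rintro ⟨h2, h3⟩
        have := lt_of_le_of_ne h2 h0.symm
        exact ⟨by linarith, by linarith⟩
    simp only [Bspline, Set.indicator, h]
  | succ n ih =>
    refine Filter.Eventually.of_forall fun x => ?_
    have h := integral_comp_sub_left (a := (0:ℝ)) (b := 1)
      (fun s => Bspline n (((n + 1 : ℕ) : ℝ) + 1 - x - s)) 1
    simp only [sub_self, sub_zero] at h
    rw [Bspline_succ, Bspline_succ, ← h]
    refine integral_congr_ae ?_
    filter_upwards [(quasiMeasurePreserving_sub_left volume x).ae ih] with s hs _
    rw [← hs]
    congr 1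
    push_cast
    ring

theorem integral_Bspline_mul_Bspline_sub (n m : ℕ) (x : ℝ) :
    ∫ y : ℝ, Bspline n y * Bspline m (x - y) = Bspline (n + m + 1) x := by
  induction m generalizing x with
  | zero =>
    rw [← integral_sub_left_eq_self _ volume x, add_zero, Bspline_succ,
      integral_of_le zero_le_one, ← integral_Ico_eq_integral_Ioc,
      ← MeasureTheory.integral_indicator measurableSet_Ico]
    congr 1 with y
    by_cases hy : y ∈ Set.Ico (0 : ℝ) 1 <;> simp [Bspline, hy]
  | succ m ih =>
    have hint : Integrable (Function.uncurry fun y s : ℝ => Bspline n y * Bspline m (x - s - y))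
        (volume.prod (volume.restrict (Set.Ioc (0:ℝ) 1))) :=
      ((integrable_Bspline n).comp_fst _).mul_bdd (c := 1)
        ((measurable_Bspline m).comp
          ((measurable_const.sub measurable_snd).sub measurable_fst)).aestronglyMeasurable
        (Filter.Eventually.of_forall fun _ => norm_Bspline_le_one m _)
    calc ∫ y : ℝ, Bspline n y * Bspline (m + 1) (x - y)
        = ∫ y : ℝ, ∫ s in Set.Ioc (0:ℝ) 1, Bspline n y * Bspline m (x - s - y) := by
          congr 1 with y
          rw [Bspline_succ, integral_of_le zero_le_one, ← MeasureTheory.integral_const_mul]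
          simp only [sub_right_comm]
      _ = ∫ s in Set.Ioc (0:ℝ) 1, Bspline (n + m + 1) (x - s) := by
          rw [integral_integral_swap hint]
          simp only [ih]
      _ = Bspline (n + (m + 1) + 1) x := by
          rw [← integral_of_le zero_le_one, ← Bspline_succ, add_assoc n m 1]

/-- The autocorrelation identity: `∫_ℝ B_n(x) B_n(x+t) dx = B_{2n+1}(n+1+t)`. -/
theorem bspline_autocorrelation (n : ℕ) (t : ℝ) :
    ∫ x : ℝ, Bspline n x * Bspline n (x + t) = Bspline (2 * n + 1) ((n : ℝ) + 1 + t) := by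
  rw [two_mul, ← integral_Bspline_mul_Bspline_sub,
    ← integral_add_right_eq_self (fun y => Bspline n y * Bspline n ((n : ℝ) + 1 + t - y)) t]
  refine MeasureTheory.integral_congr_ae ?_
  filter_upwards [ae_Bspline_symm n] with x hx
  rw [add_sub_add_right_eq_sub, hx, mul_comm]
end

section
/- Let N ∈ ℕ, 1 < p < ∞, and let w be a weight on ℝ^N with A_p^loc(w) < ∞. Then there exists a constant c > 0, depending only on w, N and p, such that for every axis-parallel cube Q ⊂ ℝ^N with |Q| = 1 and every t ≥ 1, ∫_{Q_t} w ≤ exp(c·t) · ∫_Q w, where Q_t is the cube concentric with Q, with sides parallel to those of Q, of side length t. -/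
open MeasureTheory ENNReal

/-- The axis-parallel cube in `ℝ^N` with lower corner `a` and side length `l`. -/
def cube (N : ℕ) (a : Fin N → ℝ) (l : ℝ) : Set (Fin N → ℝ) :=
  Set.univ.pi fun i => Set.Ico (a i) (a i + l)

/-- A weight on `ℝ^N`: a locally integrable function, positive almost everywhere. -/
def IsWeight {N : ℕ} (w : (Fin N → ℝ) → ℝ) : Prop :=
  LocallyIntegrable w volume ∧ ∀ᵐ x : Fin N → ℝ, 0 < w x

/-- The Muckenhoupt expression `(|Q|⁻¹∫_Q w) (|Q|⁻¹∫_Q w^{1-p'})^{p-1}` for the cube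
with corner `a` and side `l`, where `p' = p/(p-1)`. -/
noncomputable def apFactor (N : ℕ) (p : ℝ) (w : (Fin N → ℝ) → ℝ)
    (a : Fin N → ℝ) (l : ℝ) : ℝ≥0∞ :=
  ((∫⁻ x in cube N a l, ENNReal.ofReal (w x)) / ENNReal.ofReal (l ^ N)) *
    (((∫⁻ x in cube N a l, ENNReal.ofReal (w x) ^ (1 - p / (p - 1))) /
        ENNReal.ofReal (l ^ N)) ^ (p - 1))

/-- The Muckenhoupt constant `A_p(w)`: supremum over all axis-parallel cubes. -/
noncomputable def apConst (N : ℕ) (p : ℝ) (w : (Fin N → ℝ) → ℝ) : ℝ≥0∞ :=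
  ⨆ (a : Fin N → ℝ) (l : ℝ) (_ : 0 < l), apFactor N p w a l

/-- The local Muckenhoupt constant `A_p^loc(w)`: supremum over cubes of volume `≤ 1`. -/
noncomputable def apLocConst (N : ℕ) (p : ℝ) (w : (Fin N → ℝ) → ℝ) : ℝ≥0∞ :=
  ⨆ (a : Fin N → ℝ) (l : ℝ) (_ : 0 < l) (_ : l ^ N ≤ 1), apFactor N p w a l

/-- The Euclidean norm on `ℝ^N`. -/
noncomputable def euclNorm {N : ℕ} (x : Fin N → ℝ) : ℝ :=
  Real.sqrt (∑ i, (x i) ^ 2)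

/-- Hölder's inequality for a positive function and the dual power of it. -/
theorem measure_univ_rpow_le_lintegral_mul_dual {α : Type*} [MeasurableSpace α] (μ : Measure α)
    {p : ℝ} (hp : 1 < p) {f : α → ℝ≥0∞} (hf : AEMeasurable f μ)
    (hpos : ∀ᵐ x ∂μ, f x ≠ 0) (htop : ∀ᵐ x ∂μ, f x ≠ ⊤) :
    μ Set.univ ^ p ≤
      (∫⁻ x, f x ∂μ) * (∫⁻ x, f x ^ (1 - p / (p - 1)) ∂μ) ^ (p - 1) := by
  have hp0 : p ≠ 0 := by linarith
  have hp1 : p - 1 ≠ 0 := by linarith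
  have hpq : p.HolderConjugate (p / (p - 1)) := Real.HolderConjugate.conjExponent hp
  have h := ENNReal.lintegral_mul_le_Lp_mul_Lq μ hpq (hf.pow_const (1 / p))
    (hf.pow_const (-(1 / p)))
  have h1 : ∫⁻ x, ((fun x => f x ^ (1 / p)) * fun x => f x ^ (-(1 / p))) x ∂μ = μ Set.univ := by
    rw [← lintegral_one]
    refine lintegral_congr_ae ?_
    filter_upwards [hpos, htop] with x h0 ht
    simp only [Pi.mul_apply]
    rw [← ENNReal.rpow_add _ _ h0 ht]
    simp
  have h2 : ∀ x, (f x ^ (1 / p)) ^ p = f x := fun x => by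
    rw [← ENNReal.rpow_mul, one_div_mul_cancel hp0, ENNReal.rpow_one]
  have h3 : ∀ x, (f x ^ (-(1 / p))) ^ (p / (p - 1)) = f x ^ (1 - p / (p - 1)) := fun x => by
    rw [← ENNReal.rpow_mul]
    congr 1
    field_simp
    ring
  rw [h1] at h
  simp only [h2, h3] at h
  calc μ Set.univ ^ p ≤ _ := ENNReal.rpow_le_rpow h (by linarith)
    _ = _ := by
      rw [ENNReal.mul_rpow_of_nonneg _ _ (by linarith), ← ENNReal.rpow_mul, ← ENNReal.rpow_mul,
        one_div_mul_cancel hp0, ENNReal.rpow_one]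
      congr 2
      field_simp

theorem volume_cube (N : ℕ) (a : Fin N → ℝ) (l : ℝ) :
    volume (cube N a l) = ENNReal.ofReal l ^ N := by
  simp [cube, Real.volume_pi_Ico]

/-- Two unit cubes whose corners differ by at most `1/2` in each coordinate have comparable
weights. -/
theorem lintegral_cube_le_of_near {N : ℕ} {p : ℝ} (hp : 1 < p) {w : (Fin N → ℝ) → ℝ}
    (hw : IsWeight w) {a b : Fin N → ℝ} (hab : ∀ i, |b i - a i| ≤ 1 / 2) :
    ∫⁻ x in cube N b 1, ENNReal.ofReal (w x) ≤
      (((ENNReal.ofReal (1 / 2) ^ N) ^ p)⁻¹ * apLocConst N p w) *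
        ∫⁻ x in cube N a 1, ENNReal.ofReal (w x) := by
  set E := cube N (fun i => max (a i) (b i)) (1 / 2) with hE
  have hEa : E ⊆ cube N a 1 := by
    intro x hx i hi
    have h := hx i hi
    have h' := abs_le.1 (hab i)
    simp only [Set.mem_Ico] at h ⊢
    constructor
    · exact (le_max_left _ _).trans h.1
    · rcases max_cases (a i) (b i) with ⟨h1, -⟩ | ⟨h1, -⟩ <;> rw [h1] at h <;> linarith [h.2]
  have hEb : E ⊆ cube N b 1 := by
    intro x hx i hi
    have h := hx i hi
    have h' := abs_le.1 (hab i)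
    simp only [Set.mem_Ico] at h ⊢
    constructor
    · exact (le_max_right _ _).trans h.1
    · rcases max_cases (a i) (b i) with ⟨h1, -⟩ | ⟨h1, -⟩ <;> rw [h1] at h <;> linarith [h.2]
  have hmeas : AEMeasurable (fun x => ENNReal.ofReal (w x)) volume :=
    hw.1.aestronglyMeasurable.aemeasurable.ennreal_ofReal
  have hHolder := measure_univ_rpow_le_lintegral_mul_dual (volume.restrict E) hp hmeas.restrict
    (ae_restrict_of_ae (hw.2.mono fun x hx => by simpa using hx))
    (Filter.Eventually.of_forall fun x => ENNReal.ofReal_ne_top)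
  rw [Measure.restrict_apply_univ, hE, volume_cube, ← hE] at hHolder
  have hA : apFactor N p w b 1 ≤ apLocConst N p w :=
    le_iSup_of_le b (le_iSup_of_le 1 (le_iSup_of_le one_pos (le_iSup_of_le (by simp) le_rfl)))
  simp only [apFactor, one_pow, ENNReal.ofReal_one, div_one] at hA
  set v : ℝ≥0∞ := (ENNReal.ofReal (1 / 2) ^ N) ^ p with hv
  have hbase0 : ENNReal.ofReal (1 / 2) ^ N ≠ 0 := pow_ne_zero _ (by simp)
  have hbaset : ENNReal.ofReal (1 / 2) ^ N ≠ ⊤ := ENNReal.pow_ne_top ENNReal.ofReal_ne_top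
  have hv0 : v ≠ 0 := (ENNReal.rpow_pos (pos_iff_ne_zero.2 hbase0) hbaset).ne'
  have hvt : v ≠ ⊤ := ENNReal.rpow_ne_top_of_nonneg (by linarith) hbaset
  have key : v * ∫⁻ x in cube N b 1, ENNReal.ofReal (w x) ≤
      apLocConst N p w * ∫⁻ x in cube N a 1, ENNReal.ofReal (w x) := by
    calc v * ∫⁻ x in cube N b 1, ENNReal.ofReal (w x)
        ≤ ((∫⁻ x in cube N a 1, ENNReal.ofReal (w x)) *
            (∫⁻ x in cube N b 1, ENNReal.ofReal (w x) ^ (1 - p / (p - 1))) ^ (p - 1)) *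
            ∫⁻ x in cube N b 1, ENNReal.ofReal (w x) := by
          gcongr
          refine hHolder.trans ?_
          gcongr
      _ = ((∫⁻ x in cube N b 1, ENNReal.ofReal (w x)) *
            (∫⁻ x in cube N b 1, ENNReal.ofReal (w x) ^ (1 - p / (p - 1))) ^ (p - 1)) *
            ∫⁻ x in cube N a 1, ENNReal.ofReal (w x) := by ring
      _ ≤ _ := by gcongr
  calc ∫⁻ x in cube N b 1, ENNReal.ofReal (w x)
      = v⁻¹ * (v * ∫⁻ x in cube N b 1, ENNReal.ofReal (w x)) := by
        rw [← mul_assoc, ENNReal.inv_mul_cancel hv0 hvt, one_mul]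
    _ ≤ v⁻¹ * (apLocConst N p w * ∫⁻ x in cube N a 1, ENNReal.ofReal (w x)) := by gcongr
    _ = _ := by rw [mul_assoc]

/-- Chaining a one-step comparison of translates along a segment. -/
theorem le_pow_mul_of_forall_near_le {N : ℕ} {F : (Fin N → ℝ) → ℝ≥0∞} {C : ℝ≥0∞}
    (h : ∀ a b : Fin N → ℝ, (∀ i, |b i - a i| ≤ 1 / 2) → F b ≤ C * F a) (k : ℕ) :
    ∀ a b : Fin N → ℝ, (∀ i, |b i - a i| ≤ k * (1 / 2)) → F b ≤ C ^ k * F a := by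
  induction k with
  | zero =>
    intro a b hab
    have : b = a := funext fun i => by simpa [sub_eq_zero] using hab i
    simp [this]
  | succ k ih =>
    intro a b hab
    have hk : (0 : ℝ) < k + 1 := by positivity
    let m : Fin N → ℝ := fun i => a i + (b i - a i) / (k + 1)
    have hm : ∀ i, |m i - a i| ≤ 1 / 2 := fun i => by
      have := hab i
      push_cast at this
      simp only [m, add_sub_cancel_left, abs_div, abs_of_pos hk]
      rw [div_le_iff₀ hk]
      linarith
    have hb : ∀ i, |b i - m i| ≤ k * (1 / 2) := fun i => by
      have := hab i
      push_cast at this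
      have e : b i - m i = (b i - a i) * (k / (k + 1)) := by
        simp only [m]
        field_simp
        ring
      rw [e, abs_mul, abs_of_nonneg (by positivity : (0 : ℝ) ≤ k / (k + 1))]
      calc |b i - a i| * (k / (k + 1)) ≤ ((k + 1) * (1 / 2)) * (k / (k + 1)) := by gcongr
        _ = k * (1 / 2) := by field_simp
    calc F b ≤ C ^ k * F m := ih m b hb
      _ ≤ C ^ k * (C * F a) := by gcongr; exact h a m hm
      _ = C ^ (k + 1) * F a := by rw [pow_succ, mul_assoc]

/-- A cube of side `t ≤ n` is covered by a grid of `n ^ N` unit cubes. -/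
theorem cube_subset_iUnion_unit {N n : ℕ} (a : Fin N → ℝ) {t : ℝ} (ht : t ≤ n) :
    cube N a t ⊆ ⋃ j : Fin N → Fin n, cube N (fun i => a i + (j i : ℕ)) 1 := by
  intro x hx
  have hx' : ∀ i, a i ≤ x i ∧ x i < a i + t := fun i => hx i (Set.mem_univ i)
  have hlt : ∀ i, ⌊x i - a i⌋₊ < n := fun i => by
    rw [Nat.floor_lt (by linarith [(hx' i).1])]
    linarith [(hx' i).2]
  refine Set.mem_iUnion.2 ⟨fun i => ⟨⌊x i - a i⌋₊, hlt i⟩, fun i _ => ?_⟩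
  have h1 := Nat.floor_le (by linarith [(hx' i).1] : 0 ≤ x i - a i)
  have h2 := Nat.lt_floor_add_one (x i - a i)
  simp only [Set.mem_Ico]
  constructor <;> linarith

/-- Local doubling: if `w ∈ A_p^loc` then there is `c > 0` such that
`w(Q_t) ≤ e^{ct} w(Q)` for every unit cube `Q` and its concentric dilate `Q_t`, `t ≥ 1`. -/
theorem apLoc_exponential_doubling (N : ℕ) (hN : 0 < N) (p : ℝ) (hp : 1 < p)
    (w : (Fin N → ℝ) → ℝ) (hw : IsWeight w) (hfin : apLocConst N p w < ⊤) :
    ∃ c : ℝ, 0 < c ∧ ∀ (a : Fin N → ℝ) (t : ℝ), 1 ≤ t →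
      (∫⁻ x in cube N (fun i => a i - (t - 1) / 2) t, ENNReal.ofReal (w x)) ≤
        ENNReal.ofReal (Real.exp (c * t)) *
          ∫⁻ x in cube N a 1, ENNReal.ofReal (w x) := by
  set C : ℝ≥0∞ := ((ENNReal.ofReal (1 / 2) ^ N) ^ p)⁻¹ * apLocConst N p w with hC
  have hCt : C ≠ ⊤ := by
    refine ENNReal.mul_ne_top (ENNReal.inv_ne_top.2 ?_) hfin.ne
    exact (ENNReal.rpow_pos (pos_iff_ne_zero.2 (pow_ne_zero _ (by simp)))
      (ENNReal.pow_ne_top ENNReal.ofReal_ne_top)).ne'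
  set L : ℝ := Real.log (max 1 C.toReal) with hL
  have hL0 : 0 ≤ L := Real.log_nonneg (le_max_left _ _)
  have hCL : C ≤ ENNReal.ofReal (Real.exp L) := by
    rw [hL, Real.exp_log (by positivity)]
    exact (ENNReal.ofReal_toReal hCt).symm.le.trans (ENNReal.ofReal_le_ofReal (le_max_right _ _))
  have hN' : (0 : ℝ) < N := by exact_mod_cast hN
  refine ⟨(N + 2 * L) * 2, by positivity, fun a t ht => ?_⟩
  set n := ⌈t⌉₊ with hn
  have htn : t ≤ n := Nat.le_ceil t
  have hnt : (n : ℝ) ≤ 2 * t := by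
    have := Nat.ceil_lt_add_one (by linarith : 0 ≤ t)
    linarith
  have hcube : ∀ j : Fin N → Fin n,
      ∫⁻ x in cube N (fun i => a i - (t - 1) / 2 + (j i : ℕ)) 1, ENNReal.ofReal (w x) ≤
        C ^ (2 * n) * ∫⁻ x in cube N a 1, ENNReal.ofReal (w x) := by
    intro j
    refine le_pow_mul_of_forall_near_le
      (F := fun b => ∫⁻ x in cube N b 1, ENNReal.ofReal (w x))
      (fun a b hab => lintegral_cube_le_of_near hp hw hab) (2 * n) a _ fun i => ?_
    have h1 : ((j i : ℕ) : ℝ) < n := by exact_mod_cast (j i).2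
    have h0 : (0 : ℝ) ≤ ((j i : ℕ) : ℝ) := Nat.cast_nonneg _
    push_cast
    rw [abs_le]
    constructor <;> linarith
  calc ∫⁻ x in cube N (fun i => a i - (t - 1) / 2) t, ENNReal.ofReal (w x)
      ≤ ∫⁻ x in ⋃ j : Fin N → Fin n, cube N (fun i => a i - (t - 1) / 2 + (j i : ℕ)) 1,
          ENNReal.ofReal (w x) := lintegral_mono_set (cube_subset_iUnion_unit _ htn)
    _ ≤ ∑' j : Fin N → Fin n,
          ∫⁻ x in cube N (fun i => a i - (t - 1) / 2 + (j i : ℕ)) 1, ENNReal.ofReal (w x) :=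
        lintegral_iUnion_le _ _
    _ ≤ ∑' _ : Fin N → Fin n, C ^ (2 * n) * ∫⁻ x in cube N a 1, ENNReal.ofReal (w x) :=
        ENNReal.tsum_le_tsum hcube
    _ = ((n : ℝ≥0∞) ^ N * C ^ (2 * n)) * ∫⁻ x in cube N a 1, ENNReal.ofReal (w x) := by
        simp [tsum_fintype, mul_assoc]
    _ ≤ _ := by
        gcongr
        calc (n : ℝ≥0∞) ^ N * C ^ (2 * n)
            ≤ ENNReal.ofReal (Real.exp n) ^ N * ENNReal.ofReal (Real.exp L) ^ (2 * n) := by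
              gcongr
              rw [← ENNReal.ofReal_natCast]
              exact ENNReal.ofReal_le_ofReal (by linarith [Real.add_one_le_exp (n : ℝ)])
          _ = ENNReal.ofReal (Real.exp ((N + 2 * L) * n)) := by
              rw [← ENNReal.ofReal_pow (Real.exp_pos _).le, ← ENNReal.ofReal_pow (Real.exp_pos _).le,
                ← ENNReal.ofReal_mul (by positivity), ← Real.exp_nat_mul, ← Real.exp_nat_mul,
                ← Real.exp_add]
              congr 2
              push_cast
              ring
          _ ≤ _ := by
              refine ENNReal.ofReal_le_ofReal (Real.exp_le_exp.2 ?_)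
              rw [mul_assoc]
              gcongr
end

section
/- Let N ∈ ℕ, 1 < p < ∞, and let w be a weight on ℝ^N with A_p^loc(w) < ∞. Then there exists a constant c > 0, independent of the choice of cube, such that for every axis-parallel cube Q ⊂ ℝ^N with |Q| = 1 there exists a weight w̄ on ℝ^N with A_p(w̄) < ∞, w̄ = w almost everywhere on Q, and A_p(w̄) ≤ c · A_p^loc(w). -/
open MeasureTheory ENNReal

section PiMeasure

variable {ι : Type*} [Fintype ι] {α : ι → Type*} [∀ i, MeasurableSpace (α i)]

theorem measure_pi_mono {μ ν : ∀ i, Measure (α i)} (h : ∀ i, μ i ≤ ν i) :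
    Measure.pi μ ≤ Measure.pi ν := by
  refine Measure.le_iff.2 fun s hs => ?_
  rw [Measure.pi, Measure.pi, toMeasure_apply _ _ hs, toMeasure_apply _ _ hs]
  refine (OuterMeasure.le_pi.2 fun t _ => ?_ :
    OuterMeasure.pi (fun i => (μ i).toOuterMeasure) ≤
      OuterMeasure.pi fun i => (ν i).toOuterMeasure) s
  exact (OuterMeasure.pi_pi_le _ _).trans (Finset.prod_le_prod' fun i _ => h i (t i))

theorem measure_pi_const_smul (K : NNReal) (ν : ∀ i, Measure (α i))
    [∀ i, IsFiniteMeasure (ν i)] :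
    Measure.pi (fun i => K • ν i) = (K ^ Fintype.card ι) • Measure.pi ν := by
  refine Measure.pi_eq fun s _ => ?_
  simp only [Measure.smul_apply, Measure.pi_pi, ENNReal.smul_def, smul_eq_mul,
    Finset.prod_mul_distrib, Finset.prod_const, Finset.card_univ, ENNReal.coe_pow]

end PiMeasure

/-- The distance from `x` to the nearest even integer. -/
noncomputable def fold (x : ℝ) : ℝ := ‖(x : AddCircle (2 : ℝ))‖

theorem abs_fold_sub_fold_le (x y : ℝ) : |fold x - fold y| ≤ |x - y| := by
  refine (abs_norm_sub_norm_le _ _).trans ?_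
  rw [← AddCircle.coe_sub]
  simpa using QuotientAddGroup.norm_mk_le_norm (S := AddSubgroup.zmultiples (2 : ℝ)) (m := x - y)

theorem fold_nonneg (x : ℝ) : 0 ≤ fold x := norm_nonneg _

theorem fold_le_one (x : ℝ) : fold x ≤ 1 := by
  simpa [fold] using AddCircle.norm_le_half_period (2 : ℝ) (x := x) two_ne_zero

theorem measurable_fold : Measurable fold := by
  have : LipschitzWith 1 fold := LipschitzWith.of_dist_le_mul fun x y => by
    simpa [Real.dist_eq] using abs_fold_sub_fold_le x y
  exact this.continuous.measurable

theorem fold_eq_abs_sub {x : ℝ} {j : ℤ} (h : |x - 2 * j| ≤ 1) : fold x = |x - 2 * j| := by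
  have e : ((x - 2 * j : ℝ) : AddCircle (2 : ℝ)) = (x : AddCircle (2 : ℝ)) := by
    rw [AddCircle.coe_sub, sub_eq_self, AddCircle.coe_eq_zero_iff]
    exact ⟨j, by simp [mul_comm]⟩
  rw [fold, ← e]
  exact (AddCircle.norm_coe_eq_abs_iff (2 : ℝ) two_ne_zero).2 (by simpa using h)

theorem fold_eq_self {x : ℝ} (h : x ∈ Set.Icc (0 : ℝ) 1) : fold x = x := by
  have := fold_eq_abs_sub (x := x) (j := 0)
  simp only [Int.cast_zero, mul_zero, sub_zero, abs_of_nonneg h.1] at this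
  exact this h.2

theorem volume_fold_preimage_inter_le (T : Set ℝ) (k : ℤ) :
    volume (fold ⁻¹' T ∩ Set.Ico (k : ℝ) (k + 1)) ≤ volume T := by
  rcases Int.even_or_odd' k with ⟨j, rfl | rfl⟩
  · rw [← measure_preimage_add_right volume (-(2 * j) : ℝ) T]
    refine measure_mono ?_
    rintro x ⟨hx, h1, h2⟩
    push_cast at h1 h2
    have e : |x - 2 * j| = x - 2 * j := abs_of_nonneg (by linarith)
    rw [Set.mem_preimage, fold_eq_abs_sub (j := j) (by rw [e]; linarith), e] at hx
    exact hx
  · rw [← (Measure.measurePreserving_sub_left volume (2 * j + 2 : ℝ)).measure_preimage_equiv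
      (f := MeasurableEquiv.subLeft (2 * j + 2 : ℝ)) T]
    refine measure_mono ?_
    rintro x ⟨hx, h1, h2⟩
    push_cast at h1 h2
    have e : |x - 2 * (j + 1 : ℤ)| = 2 * j + 2 - x := by
      push_cast
      rw [abs_of_nonpos (by linarith)]
      ring
    rw [Set.mem_preimage, fold_eq_abs_sub (j := j + 1) (by rw [e]; linarith), e] at hx
    exact hx

theorem volume_fold_preimage_inter_Ico_le (T : Set ℝ) (b : ℝ) {l : ℝ} (hl : 0 < l) :
    volume (fold ⁻¹' T ∩ Set.Ico b (b + l)) ≤ ENNReal.ofReal (l + 2) * volume T := by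
  have hsub : fold ⁻¹' T ∩ Set.Ico b (b + l) ⊆
      ⋃ k ∈ Finset.Icc ⌊b⌋ ⌊b + l⌋, fold ⁻¹' T ∩ Set.Ico (k : ℝ) (k + 1) := by
    rintro x ⟨hx, h1, h2⟩
    simp only [Set.mem_iUnion]
    exact ⟨⌊x⌋, Finset.mem_Icc.2 ⟨Int.floor_mono h1, Int.floor_mono h2.le⟩, hx,
      Int.floor_le x, Int.lt_floor_add_one x⟩
  have hcard : ((Finset.Icc ⌊b⌋ ⌊b + l⌋).card : ℝ) ≤ l + 2 := by
    have h : ⌊b⌋ ≤ ⌊b + l⌋ := Int.floor_mono (by linarith)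
    have e : (((Finset.Icc ⌊b⌋ ⌊b + l⌋).card : ℤ) : ℝ) = ((⌊b + l⌋ + 1 - ⌊b⌋ : ℤ) : ℝ) := by
      rw [Int.card_Icc, Int.toNat_of_nonneg (by omega)]
    rw [Int.cast_natCast] at e
    rw [e]
    push_cast
    linarith [Int.floor_le (b + l), Int.lt_floor_add_one b]
  calc volume (fold ⁻¹' T ∩ Set.Ico b (b + l))
      ≤ ∑ k ∈ Finset.Icc ⌊b⌋ ⌊b + l⌋, volume (fold ⁻¹' T ∩ Set.Ico (k : ℝ) (k + 1)) :=
        (measure_mono hsub).trans (measure_biUnion_finset_le _ _)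
    _ ≤ ∑ _k ∈ Finset.Icc ⌊b⌋ ⌊b + l⌋, volume T :=
        Finset.sum_le_sum fun k _ => volume_fold_preimage_inter_le T k
    _ = ((Finset.Icc ⌊b⌋ ⌊b + l⌋).card : ℝ≥0∞) * volume T := by simp
    _ ≤ ENNReal.ofReal (l + 2) * volume T := by
        gcongr
        rw [← ENNReal.ofReal_natCast]
        exact ENNReal.ofReal_le_ofReal hcard

theorem exists_fold_mem_Icc (b l : ℝ) :
    ∃ b' : ℝ, ∀ x ∈ Set.Ico b (b + l), fold x ∈ Set.Icc b' (b' + min l 1) := by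
  rcases le_total 1 l with h | h
  · exact ⟨0, fun x _ => ⟨fold_nonneg x, by simpa [min_eq_right h] using fold_le_one x⟩⟩
  · refine ⟨fold (b + l / 2) - l / 2, fun x hx => ?_⟩
    have h1 : |x - (b + l / 2)| ≤ l / 2 := abs_le.2 ⟨by linarith [hx.1], by linarith [hx.2]⟩
    have h2 := abs_le.1 ((abs_fold_sub_fold_le x (b + l / 2)).trans h1)
    rw [min_eq_left h]
    exact ⟨by linarith [h2.1], by linarith [h2.2]⟩

/-- Reflection at the faces of the unit interval with left endpoint `a`. -/
noncomputable def foldAt (a x : ℝ) : ℝ := a + fold (x - a)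

theorem measurable_foldAt (a : ℝ) : Measurable (foldAt a) :=
  (measurable_fold.comp (measurable_id.sub_const a)).const_add a

theorem exists_map_foldAt_le (a b : ℝ) {l : ℝ} (hl : 0 < l) :
    ∃ b' : ℝ, Measure.map (foldAt a) (volume.restrict (Set.Ico b (b + l))) ≤
      Real.toNNReal (l + 2) • volume.restrict (Set.Ico b' (b' + min l 1)) := by
  obtain ⟨b', hb'⟩ := exists_fold_mem_Icc (b - a) l
  refine ⟨a + b', Measure.le_iff.2 fun S hS => ?_⟩
  rw [Measure.map_apply (measurable_foldAt a) hS,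
    Measure.restrict_apply (measurable_foldAt a hS), Measure.restrict_congr_set Ico_ae_eq_Icc,
    Measure.smul_apply, Measure.restrict_apply hS]
  set T : Set ℝ := (fun x => a + x) ⁻¹' (S ∩ Set.Icc (a + b') (a + b' + min l 1))
  have hTv : volume T = volume (S ∩ Set.Icc (a + b') (a + b' + min l 1)) :=
    measure_preimage_add volume a _
  rw [← hTv, ENNReal.smul_def, smul_eq_mul]
  refine le_trans ?_ (volume_fold_preimage_inter_Ico_le T (b - a) hl)
  rw [← measure_preimage_add_right volume (-a) (fold ⁻¹' T ∩ Set.Ico (b - a) (b - a + l))]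
  refine measure_mono ?_
  rintro x ⟨hx, h1, h2⟩
  have hI : x - a ∈ Set.Ico (b - a) (b - a + l) := ⟨by linarith, by linarith⟩
  have := hb' _ hI
  have hS' : foldAt a x ∈ S ∩ Set.Icc (a + b') (a + b' + min l 1) :=
    ⟨hx, by rw [foldAt]; linarith [this.1], by rw [foldAt]; linarith [this.2]⟩
  exact ⟨hS', hI⟩

section FoldCube

variable {N : ℕ}

/-- Coordinatewise reflection at the faces of the unit cube with lower corner `a`. -/
noncomputable def foldCube (a x : Fin N → ℝ) : Fin N → ℝ := fun i => foldAt (a i) (x i)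

theorem measurable_foldCube (a : Fin N → ℝ) : Measurable (foldCube a) :=
  measurable_pi_lambda _ fun i => (measurable_foldAt (a i)).comp (measurable_pi_apply i)

theorem foldCube_eq_self {a x : Fin N → ℝ} (hx : x ∈ cube N a 1) : foldCube a x = x := by
  funext i
  have := hx i (Set.mem_univ i)
  rw [foldCube, foldAt, fold_eq_self ⟨by linarith [this.1], by linarith [this.2]⟩]
  ring

theorem volume_restrict_cube (b : Fin N → ℝ) (l : ℝ) :
    volume.restrict (cube N b l) =
      Measure.pi fun i => (volume : Measure ℝ).restrict (Set.Ico (b i) (b i + l)) :=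
  Measure.restrict_pi_pi _ _

theorem exists_map_foldCube_le (a b : Fin N → ℝ) {l : ℝ} (hl : 0 < l) :
    ∃ b' : Fin N → ℝ, Measure.map (foldCube a) (volume.restrict (cube N b l)) ≤
      (Real.toNNReal (l + 2) ^ N) • volume.restrict (cube N b' (min l 1)) := by
  choose b' hb' using fun i => exists_map_foldAt_le (a i) (b i) hl
  refine ⟨b', ?_⟩
  rw [volume_restrict_cube, volume_restrict_cube]
  have h1 := Measure.pi_map_pi (μ := fun i => (volume : Measure ℝ).restrict
    (Set.Ico (b i) (b i + l))) (f := fun i => foldAt (a i))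
    fun i => (measurable_foldAt (a i)).aemeasurable
  have h2 := measure_pi_const_smul (Real.toNNReal (l + 2))
    fun i => (volume : Measure ℝ).restrict (Set.Ico (b' i) (b' i + min l 1))
  rw [Fintype.card_fin] at h2
  rw [← h2]
  exact h1.le.trans (measure_pi_mono hb')

theorem iUnion_cube_eq_univ :
    ⋃ n : ℕ, cube N (fun _ => -((n : ℝ) + 1)) (2 * ((n : ℝ) + 1)) = Set.univ := by
  refine Set.eq_univ_of_forall fun x => Set.mem_iUnion.2 ?_
  obtain ⟨n, hn⟩ := exists_nat_ge ‖x‖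
  refine ⟨n, fun i _ => ?_⟩
  have := abs_le.1 ((norm_le_pi_norm x i).trans hn)
  exact ⟨by linarith [this.1], by linarith [this.2]⟩

theorem quasiMeasurePreserving_foldCube (a : Fin N → ℝ) :
    Measure.QuasiMeasurePreserving (foldCube a) volume volume := by
  refine ⟨measurable_foldCube a, Measure.AbsolutelyContinuous.mk fun s hs h0 => ?_⟩
  rw [Measure.map_apply (measurable_foldCube a) hs, ← Set.inter_univ (foldCube a ⁻¹' s),
    ← iUnion_cube_eq_univ, Set.inter_iUnion, measure_iUnion_null_iff]
  intro n
  obtain ⟨b', hb'⟩ := exists_map_foldCube_le a (fun _ => -((n : ℝ) + 1))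
    (l := 2 * ((n : ℝ) + 1)) (by positivity)
  rw [← Measure.restrict_apply (measurable_foldCube a hs),
    ← Measure.map_apply (measurable_foldCube a) hs, ← nonpos_iff_eq_zero]
  refine (hb' s).trans ?_
  rw [Measure.smul_apply, Measure.restrict_apply hs, measure_inter_null_of_null_left _ h0,
    smul_zero]

theorem locallyIntegrable_comp_foldCube {w : (Fin N → ℝ) → ℝ}
    (hw : LocallyIntegrable w volume) (a : Fin N → ℝ) :
    LocallyIntegrable (fun x => w (foldCube a x)) volume := by
  rw [locallyIntegrable_iff]
  intro k hk
  obtain ⟨R, hR⟩ := hk.isBounded.exists_norm_le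
  set L := max R 0 + 1
  have hL0 : 0 < L := by positivity
  have hsub : k ⊆ cube N (fun _ => -L) (2 * L) := by
    intro x hx i _
    have := abs_le.1 ((norm_le_pi_norm x i).trans ((hR x hx).trans (le_max_left R 0)))
    exact ⟨by linarith [this.1], by linarith [this.2]⟩
  obtain ⟨b', hb'⟩ := exists_map_foldCube_le a (fun _ => -L) (l := 2 * L) (by positivity)
  have hint : IntegrableOn w (cube N b' (min (2 * L) 1)) volume := by
    refine (hw.integrableOn_isCompact (isCompact_univ_pi fun i =>
      isCompact_Icc (a := b' i) (b := b' i + min (2 * L) 1))).mono_set ?_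
    exact Set.pi_mono fun i _ => Set.Ico_subset_Icc_self
  have h2 : Integrable w (Measure.map (foldCube a)
      (volume.restrict (cube N (fun _ => -L) (2 * L)))) :=
    (hint.smul_measure_nnreal).mono_measure hb'
  exact IntegrableOn.mono_set (h2.comp_measurable (measurable_foldCube a)) hsub

theorem isWeight_comp_foldCube {w : (Fin N → ℝ) → ℝ} (hw : IsWeight w) (a : Fin N → ℝ) :
    IsWeight fun x => w (foldCube a x) :=
  ⟨locallyIntegrable_comp_foldCube hw.1 a, (quasiMeasurePreserving_foldCube a).ae hw.2⟩

theorem exists_average_comp_foldCube_le (a b : Fin N → ℝ) {l : ℝ} (hl : 0 < l) :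
    ∃ b' : Fin N → ℝ, ∀ G : (Fin N → ℝ) → ℝ≥0∞, AEMeasurable G volume →
      (∫⁻ x in cube N b l, G (foldCube a x)) / ENNReal.ofReal (l ^ N) ≤
        3 ^ N * ((∫⁻ x in cube N b' (min l 1), G x) / ENNReal.ofReal (min l 1 ^ N)) := by
  obtain ⟨b', hb'⟩ := exists_map_foldCube_le a b hl
  refine ⟨b', fun G hG => ?_⟩
  have hm : 0 < min l 1 := lt_min hl one_pos
  have hac : Measure.map (foldCube a) (volume.restrict (cube N b l)) ≪ volume :=
    (Measure.absolutelyContinuous_of_le Measure.restrict_le_self).map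
      (measurable_foldCube a) |>.trans (quasiMeasurePreserving_foldCube a).2
  have hle : ∫⁻ x in cube N b l, G (foldCube a x) ≤
      ENNReal.ofReal (l + 2) ^ N * ∫⁻ x in cube N b' (min l 1), G x := by
    rw [← lintegral_map' (hG.mono_ac hac) (measurable_foldCube a).aemeasurable]
    refine (lintegral_mono' hb' le_rfl).trans ?_
    rw [lintegral_smul_measure, ENNReal.smul_def, smul_eq_mul, ENNReal.coe_pow]
    rfl
  have hconst : ENNReal.ofReal (l + 2) ^ N ≤
      3 ^ N * (ENNReal.ofReal (l ^ N) / ENNReal.ofReal (min l 1 ^ N)) := by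
    rw [← ENNReal.ofReal_div_of_pos (by positivity), ← div_pow,
      ENNReal.ofReal_pow (by positivity), ← mul_pow]
    gcongr
    rw [← ENNReal.ofReal_ofNat, ← ENNReal.ofReal_mul (by norm_num)]
    refine ENNReal.ofReal_le_ofReal ?_
    rw [← mul_div_assoc, le_div_iff₀ hm]
    rcases le_total 1 l with h | h
    · rw [min_eq_right h]; linarith
    · rw [min_eq_left h]; nlinarith
  have h0 : ENNReal.ofReal (l ^ N) ≠ 0 := by
    rw [Ne, ENNReal.ofReal_eq_zero, not_le]; positivity
  refine ENNReal.div_le_of_le_mul (hle.trans ((mul_le_mul_left hconst _).trans_eq ?_))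
  simp only [div_eq_mul_inv]
  ring

theorem apConst_comp_foldCube_le {p : ℝ} (hp : 1 < p) {w : (Fin N → ℝ) → ℝ}
    (hw : AEMeasurable w volume) (a : Fin N → ℝ) :
    apConst N p (fun x => w (foldCube a x)) ≤
      3 ^ N * (3 ^ N) ^ (p - 1) * apLocConst N p w := by
  refine iSup_le fun b => iSup_le fun l => iSup_le fun hl => ?_
  obtain ⟨b', hb'⟩ := exists_average_comp_foldCube_le a b hl
  have hm : 0 < min l 1 := lt_min hl one_pos
  have h1 := hb' (fun x => ENNReal.ofReal (w x)) hw.ennreal_ofReal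
  have h2 := hb' (fun x => ENNReal.ofReal (w x) ^ (1 - p / (p - 1)))
    (hw.ennreal_ofReal.pow_const _)
  have hp1 : 0 ≤ p - 1 := by linarith
  have h3 : apFactor N p w b' (min l 1) ≤ apLocConst N p w :=
    le_iSup_of_le b' <| le_iSup_of_le (min l 1) <| le_iSup_of_le hm <|
      le_iSup_of_le (pow_le_one₀ hm.le (min_le_right _ _)) le_rfl
  refine (mul_le_mul' h1 (ENNReal.rpow_le_rpow h2 hp1)).trans ?_
  rw [ENNReal.mul_rpow_of_nonneg _ _ hp1, mul_mul_mul_comm]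
  exact mul_le_mul_right h3 _

end FoldCube

/-- Rychkov's extension lemma: for `w ∈ A_p^loc` there is `c > 0` such that for every
unit cube `Q` there is `w̄ ∈ A_p` with `w̄ = w` on `Q` and `A_p(w̄) ≤ c A_p^loc(w)`. -/
theorem apLoc_extension (N : ℕ) (hN : 0 < N) (p : ℝ) (hp : 1 < p)
    (w : (Fin N → ℝ) → ℝ) (hw : IsWeight w) (hfin : apLocConst N p w < ⊤) :
    ∃ c : ℝ, 0 < c ∧ ∀ a : Fin N → ℝ, ∃ wbar : (Fin N → ℝ) → ℝ,
      IsWeight wbar ∧ apConst N p wbar < ⊤ ∧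
      (∀ᵐ x : Fin N → ℝ, x ∈ cube N a 1 → wbar x = w x) ∧
      apConst N p wbar ≤ ENNReal.ofReal c * apLocConst N p w := by
  refine ⟨3 ^ N * (3 ^ N) ^ (p - 1), by positivity, fun a => ?_⟩
  have hc : ENNReal.ofReal (3 ^ N * (3 ^ N) ^ (p - 1)) = 3 ^ N * (3 ^ N) ^ (p - 1) := by
    rw [ENNReal.ofReal_mul (by positivity), ← ENNReal.ofReal_rpow_of_pos (by positivity),
      ENNReal.ofReal_pow (by norm_num), ENNReal.ofReal_ofNat]
  have hle : apConst N p (fun x => w (foldCube a x)) ≤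
      ENNReal.ofReal (3 ^ N * (3 ^ N) ^ (p - 1)) * apLocConst N p w :=
    hc ▸ apConst_comp_foldCube_le hp hw.1.aestronglyMeasurable.aemeasurable a
  exact ⟨fun x => w (foldCube a x), isWeight_comp_foldCube hw a,
    hle.trans_lt (ENNReal.mul_lt_top ENNReal.ofReal_lt_top hfin),
    .of_forall fun x hx => congrArg w (foldCube_eq_self hx), hle⟩
end
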